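/- arXiv:2506.09913 — 7 statements merged into one kernel-verified Lean document; each statement's English description precedes it below -/
import Mathlib

section
/- Let V be a real Hilbert space, B : V × V → ℝ a continuous bilinear form, L : V → ℝ a continuous linear functional, V_h a subspace of V, and J : V → ℝ twice continuously differentiable. Suppose u ∈ V satisfies B(u, φ) = L(φ) for all φ ∈ V, u_h ∈ V_h satisfies B(u_h, φ_h) = L(φ_h) for all φ_h ∈ V_h, and z ∈ V satisfies B(φ, z) = J'(u_h)(φ) for all φ ∈ V. Then, with e := u − u_h, the error representation holds: J(u) − J(u_h) = L(z) − B(u_h, z) + ∫₀¹ (1 − s) · J''(u_h + s·e)(e, e) ds. -/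
/-- Second-order Taylor formula with integral remainder along the segment from `x` to `x + v`. -/
theorem ContDiff.sub_eq_fderiv_add_integral_fderiv_fderiv
    {E : Type*} [NormedAddCommGroup E] [NormedSpace ℝ E]
    {f : E → ℝ} (hf : ContDiff ℝ 2 f) (x v : E) :
    f (x + v) - f x =
      fderiv ℝ f x v +
        ∫ s in (0:ℝ)..1, (1 - s) * (fderiv ℝ (fderiv ℝ f) (x + s • v) v v) := by
  have hf' : ContDiff ℝ 1 (fderiv ℝ f) := hf.fderiv_right (by norm_num)
  have hline (s : ℝ) : HasDerivAt (fun t : ℝ => x + t • v) v s := by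
    simpa using ((hasDerivAt_id s).smul_const v).const_add x
  have hderiv (s : ℝ) : HasDerivAt
      (fun t : ℝ => (1 - t) * fderiv ℝ f (x + t • v) v + f (x + t • v))
      ((1 - s) * (fderiv ℝ (fderiv ℝ f) (x + s • v) v v)) s := by
    have h₁ : HasDerivAt (fun t : ℝ => f (x + t • v)) (fderiv ℝ f (x + s • v) v) s :=
      (hf.differentiable (by norm_num) _).hasFDerivAt.comp_hasDerivAt s (hline s)
    have h₂ : HasDerivAt (fun t : ℝ => fderiv ℝ f (x + t • v))
        (fderiv ℝ (fderiv ℝ f) (x + s • v) v) s :=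
      (hf'.differentiable (by norm_num) _).hasFDerivAt.comp_hasDerivAt s (hline s)
    have h₃ : HasDerivAt (fun t : ℝ => fderiv ℝ f (x + t • v) v)
        (fderiv ℝ (fderiv ℝ f) (x + s • v) v v) s := by
      simpa using h₂.clm_apply (hasDerivAt_const s v)
    exact ((((hasDerivAt_id s).const_sub 1).mul h₃).add h₁).congr_deriv (by simp)
  have hcont : Continuous fun s : ℝ =>
      (1 - s) * (fderiv ℝ (fderiv ℝ f) (x + s • v) v v) := by
    have := hf'.continuous_fderiv (by norm_num)
    fun_prop
  rw [intervalIntegral.integral_eq_sub_of_hasDerivAt (fun s _ => hderiv s)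
    (hcont.intervalIntegrable 0 1)]
  simp
  ring

/-- Error representation (Lemma 2): with `e := u - u_h`,
`J(u) - J(u_h) = L(z) - B(u_h, z) + ∫₀¹ (1 - s) J''(u_h + s e)(e, e) ds`,
where `z` solves the continuous adjoint problem `B(φ, z) = J'(u_h)(φ)`. -/
theorem error_representation
    {V : Type*} [NormedAddCommGroup V] [InnerProductSpace ℝ V] [CompleteSpace V]
    (B : V →L[ℝ] V →L[ℝ] ℝ) (L : V →L[ℝ] ℝ) (Vh : Submodule ℝ V)
    (J : V → ℝ) (hJ : ContDiff ℝ 2 J)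
    (u : V) (hu : ∀ φ : V, B u φ = L φ)
    (u_h : V) (hu_h_mem : u_h ∈ Vh)
    (hu_h : ∀ φ_h ∈ Vh, B u_h φ_h = L φ_h)
    (z : V) (hz : ∀ φ : V, B φ z = fderiv ℝ J u_h φ) :
    J u - J u_h =
      L z - B u_h z +
        ∫ s in (0:ℝ)..1,
          (1 - s) *
            (fderiv ℝ (fderiv ℝ J) (u_h + s • (u - u_h)) (u - u_h) (u - u_h)) := by
  have hres : fderiv ℝ J u_h (u - u_h) = L z - B u_h z := by
    rw [← hz, map_sub, sub_apply, hu]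
  simpa [hres] using hJ.sub_eq_fderiv_add_integral_fderiv_fderiv u_h (u - u_h)
end

section
/- Let V be a real Hilbert space, B : V × V → ℝ a continuous bilinear form, L : V → ℝ a continuous linear functional, V_h ⊆ V_h⁺ subspaces of V, and J : V → ℝ twice continuously differentiable. Suppose u_h ∈ V_h satisfies B(u_h, φ_h) = L(φ_h) for all φ_h ∈ V_h, u_h⁺ ∈ V_h⁺ satisfies B(u_h⁺, φ) = L(φ) for all φ ∈ V_h⁺, and z_h⁺ ∈ V_h⁺ satisfies B(φ, z_h⁺) = J'(u_h)(φ) for all φ ∈ V_h⁺. Then, with e_h⁺ := u_h⁺ − u_h, the discrete error representation holds: J(u_h⁺) − J(u_h) = L(z_h⁺) − B(u_h, z_h⁺) + ∫₀¹ (1 − s) · J''(u_h + s·e_h⁺)(e_h⁺, e_h⁺) ds. -/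
/-- First-order Taylor expansion of a `C²` function with integral remainder. -/
theorem ContDiff.sub_eq_fderiv_add_integral {E F : Type*}
    [NormedAddCommGroup E] [NormedSpace ℝ E]
    [NormedAddCommGroup F] [NormedSpace ℝ F] [CompleteSpace F]
    {f : E → F} (hf : ContDiff ℝ 2 f) (x v : E) :
    f (x + v) - f x =
      fderiv ℝ f x v +
        ∫ s in (0:ℝ)..1, (1 - s) • fderiv ℝ (fderiv ℝ f) (x + s • v) v v := by
  have hf' : ContDiff ℝ 1 (fderiv ℝ f) := hf.fderiv_right (by norm_num)
  have hline (s : ℝ) : HasDerivAt (fun t : ℝ => x + t • v) v s := by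
    simpa using ((hasDerivAt_id s).smul_const v).const_add x
  have hderiv (s : ℝ) : HasDerivAt
      (fun t : ℝ => (1 - t) • fderiv ℝ f (x + t • v) v + f (x + t • v))
      ((1 - s) • fderiv ℝ (fderiv ℝ f) (x + s • v) v v) s := by
    have h₀ : HasDerivAt (fun t : ℝ => f (x + t • v)) (fderiv ℝ f (x + s • v) v) s :=
      (hf.differentiable (by norm_num) _).hasFDerivAt.comp_hasDerivAt s (hline s)
    have h₁ : HasDerivAt (fun t : ℝ => fderiv ℝ f (x + t • v))
        (fderiv ℝ (fderiv ℝ f) (x + s • v) v) s :=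
      (hf'.differentiable (by norm_num) _).hasFDerivAt.comp_hasDerivAt s (hline s)
    have h₂ : HasDerivAt (fun t : ℝ => fderiv ℝ f (x + t • v) v)
        (fderiv ℝ (fderiv ℝ f) (x + s • v) v v) s := by
      simpa using h₁.clm_apply (hasDerivAt_const s v)
    have h₃ : HasDerivAt (fun t : ℝ => 1 - t) (-1) s := (hasDerivAt_id s).const_sub 1
    refine ((h₃.fun_smul h₂).fun_add h₀).congr_deriv ?_
    simp
  have hcont : Continuous fun s : ℝ => (1 - s) • fderiv ℝ (fderiv ℝ f) (x + s • v) v v := by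
    have := hf'.continuous_fderiv (by norm_num)
    fun_prop
  rw [intervalIntegral.integral_eq_sub_of_hasDerivAt (fun s _ => hderiv s)
    (hcont.intervalIntegrable 0 1)]
  simp only [one_smul, zero_smul, sub_self, sub_zero, add_zero, zero_add]
  abel

/-- Discrete error representation (Lemma 3): with `e_h⁺ := u_h⁺ - u_h`,
`J(u_h⁺) - J(u_h) = L(z_h⁺) - B(u_h, z_h⁺) + ∫₀¹ (1 - s) J''(u_h + s e_h⁺)(e_h⁺, e_h⁺) ds`,
where `z_h⁺` solves the discrete adjoint problem on the enriched space `V_h⁺`. -/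
theorem discrete_error_representation
    {V : Type*} [NormedAddCommGroup V] [InnerProductSpace ℝ V] [CompleteSpace V]
    (B : V →L[ℝ] V →L[ℝ] ℝ) (L : V →L[ℝ] ℝ)
    (Vh Vhp : Submodule ℝ V) (hVV : Vh ≤ Vhp)
    (J : V → ℝ) (hJ : ContDiff ℝ 2 J)
    (u_h : V) (hu_h_mem : u_h ∈ Vh)
    (hu_h : ∀ φ_h ∈ Vh, B u_h φ_h = L φ_h)
    (u_hp : V) (hu_hp_mem : u_hp ∈ Vhp)
    (hu_hp : ∀ φ ∈ Vhp, B u_hp φ = L φ)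
    (z_hp : V) (hz_hp_mem : z_hp ∈ Vhp)
    (hz_hp : ∀ φ ∈ Vhp, B φ z_hp = fderiv ℝ J u_h φ) :
    J u_hp - J u_h =
      L z_hp - B u_h z_hp +
        ∫ s in (0:ℝ)..1,
          (1 - s) *
            (fderiv ℝ (fderiv ℝ J) (u_h + s • (u_hp - u_h)) (u_hp - u_h) (u_hp - u_h)) := by
  have hmem : u_hp - u_h ∈ Vhp := Vhp.sub_mem hu_hp_mem (hVV hu_h_mem)
  have hres : fderiv ℝ J u_h (u_hp - u_h) = L z_hp - B u_h z_hp := by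
    rw [← hz_hp _ hmem, map_sub, sub_apply, hu_hp _ hz_hp_mem]
  simpa [hres] using hJ.sub_eq_fderiv_add_integral u_h (u_hp - u_h)
end

section
/- Let V be a real Hilbert space, B : V × V → ℝ a continuous bilinear form, L : V → ℝ a continuous linear functional, V_h ⊆ V_h⁺ subspaces of V, and J : V → ℝ twice continuously differentiable. Suppose u ∈ V, u_h ∈ V_h, u_h⁺ ∈ V_h⁺, and z_h⁺ ∈ V_h⁺ satisfy: B(u_h, φ_h) = L(φ_h) for all φ_h ∈ V_h; B(u_h⁺, φ) = L(φ) for all φ ∈ V_h⁺; and B(φ, z_h⁺) = J'(u_h)(φ) for all φ ∈ V_h⁺. Assume the saturation property: there exists b_h with 0 < b_h < 1 such that |J(u) − J(u_h⁺)| ≤ b_h · |J(u) − J(u_h)|. Define, with e_h⁺ := u_h⁺ − u_h, the estimate η₁ := L(z_h⁺) − B(u_h, z_h⁺) + ∫₀¹ (1 − s) · J''(u_h + s·e_h⁺)(e_h⁺, e_h⁺) ds. Then |J(u) − J(u_h)| ≤ (1/(1 − b_h)) · |η₁|. -/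
/-- Second-order Taylor formula with integral remainder, along a segment in a normed space. -/
theorem intervalIntegral_one_sub_mul_fderiv_fderiv
    {E : Type*} [NormedAddCommGroup E] [NormedSpace ℝ E] {f : E → ℝ} (hf : ContDiff ℝ 2 f)
    (x e : E) :
    ∫ s in (0:ℝ)..1, (1 - s) * fderiv ℝ (fderiv ℝ f) (x + s • e) e e =
      f (x + e) - f x - fderiv ℝ f x e := by
  have hf' : ContDiff ℝ 1 (fderiv ℝ f) := hf.fderiv_right (by norm_num)
  have hline (s : ℝ) : HasDerivAt (fun s : ℝ => x + s • e) e s := by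
    simpa using ((hasDerivAt_id s).smul_const e).const_add x
  have hderiv (s : ℝ) : HasDerivAt
      (fun s : ℝ => (1 - s) * fderiv ℝ f (x + s • e) e + f (x + s • e))
      ((1 - s) * fderiv ℝ (fderiv ℝ f) (x + s • e) e e) s := by
    have h₀ : HasDerivAt (fun s : ℝ => f (x + s • e)) (fderiv ℝ f (x + s • e) e) s :=
      ((hf.differentiable (by norm_num)) (x + s • e)).hasFDerivAt.comp_hasDerivAt s (hline s)
    have h₁ : HasDerivAt (fun s : ℝ => fderiv ℝ f (x + s • e))
        (fderiv ℝ (fderiv ℝ f) (x + s • e) e) s :=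
      ((hf'.differentiable (by norm_num)) (x + s • e)).hasFDerivAt.comp_hasDerivAt s (hline s)
    have h₂ : HasDerivAt (fun s : ℝ => fderiv ℝ f (x + s • e) e)
        (fderiv ℝ (fderiv ℝ f) (x + s • e) e e) s := by
      simpa using h₁.clm_apply (hasDerivAt_const s e)
    refine ((((hasDerivAt_id' s).const_sub 1).mul h₂).add h₀).congr_deriv ?_
    ring
  have hcont : Continuous fun s : ℝ => (1 - s) * fderiv ℝ (fderiv ℝ f) (x + s • e) e e := by
    have := hf'.continuous_fderiv (by norm_num)
    fun_prop
  rw [intervalIntegral.integral_eq_sub_of_hasDerivAt (fun s _ => hderiv s)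
    (hcont.intervalIntegrable 0 1)]
  simp only [sub_self, zero_mul, one_smul, zero_add, sub_zero, zero_smul, add_zero, one_mul]
  ring

/-- Reliability of the estimate η₁ (Lemma 6): under the saturation assumption
`|J(u) - J(u_h⁺)| ≤ b_h |J(u) - J(u_h)|` with `0 < b_h < 1`, the estimate
`η₁ := L(z_h⁺) - B(u_h, z_h⁺) + ∫₀¹ (1-s) J''(u_h + s e_h⁺)(e_h⁺, e_h⁺) ds`
satisfies `|J(u) - J(u_h)| ≤ (1/(1 - b_h)) |η₁|`. -/
theorem eta1_is_reliable
    {V : Type*} [NormedAddCommGroup V] [InnerProductSpace ℝ V] [CompleteSpace V]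
    (B : V →L[ℝ] V →L[ℝ] ℝ) (L : V →L[ℝ] ℝ)
    (Vh Vhp : Submodule ℝ V) (hVV : Vh ≤ Vhp)
    (J : V → ℝ) (hJ : ContDiff ℝ 2 J)
    (u : V)
    (u_h : V) (hu_h_mem : u_h ∈ Vh)
    (hu_h : ∀ φ_h ∈ Vh, B u_h φ_h = L φ_h)
    (u_hp : V) (hu_hp_mem : u_hp ∈ Vhp)
    (hu_hp : ∀ φ ∈ Vhp, B u_hp φ = L φ)
    (z_hp : V) (hz_hp_mem : z_hp ∈ Vhp)
    (hz_hp : ∀ φ ∈ Vhp, B φ z_hp = fderiv ℝ J u_h φ)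
    (b_h : ℝ) (hb0 : 0 < b_h) (hb1 : b_h < 1)
    (hsat : |J u - J u_hp| ≤ b_h * |J u - J u_h|) :
    |J u - J u_h| ≤
      (1 / (1 - b_h)) *
        |L z_hp - B u_h z_hp +
          ∫ s in (0:ℝ)..1,
            (1 - s) *
              (fderiv ℝ (fderiv ℝ J) (u_h + s • (u_hp - u_h)) (u_hp - u_h) (u_hp - u_h))| := by
  have hres : L z_hp - B u_h z_hp = fderiv ℝ J u_h (u_hp - u_h) := by
    rw [← hz_hp _ (Vhp.sub_mem hu_hp_mem (hVV hu_h_mem)), map_sub,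
      sub_apply, hu_hp z_hp hz_hp_mem]
  rw [intervalIntegral_one_sub_mul_fderiv_fderiv hJ, hres, add_sub_cancel, add_sub_cancel,
    one_div, inv_mul_eq_div, le_div_iff₀ (sub_pos.mpr hb1)]
  linarith [abs_sub_le (J u) (J u_hp) (J u_h)]
end

section
/- Let V be a real Hilbert space, B : V × V → ℝ a continuous bilinear form that is nondegenerate in its second argument (for w ∈ V, if B(φ, w) = 0 for all φ ∈ V then w = 0), L : V → ℝ a continuous linear functional, V_h a subspace of V, and J : V → ℝ Fréchet differentiable. Suppose u ∈ V satisfies B(u, φ) = L(φ) for all φ ∈ V; u_h ∈ V_h satisfies B(u_h, φ_h) = L(φ_h) for all φ_h ∈ V_h; z ∈ V satisfies B(φ, z) = J'(u_h)(φ) for all φ ∈ V; and there exists ψ_h ∈ V_h such that J'(u_h)(φ) = B(φ, ψ_h) for all φ ∈ V. Then the estimate η₂ := L(z) − B(u_h, z) equals 0, and consequently, if J(u) ≠ J(u_h), there exists no constant C > 0 such that |J(u) − J(u_h)| ≤ C · |η₂| (i.e., η₂ is not a reliable estimate). -/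
/-- Theorem 1 of the paper: if `J'(u_h)(·) = B(·, ψ_h)` for some `ψ_h ∈ V_h`,
then the estimate `η₂ := L(z) - B(u_h, z)` vanishes, so whenever
`J(u) ≠ J(u_h)` there is no constant `C > 0` with `|J(u) - J(u_h)| ≤ C |η₂|`. -/
theorem eta2_not_reliable
    {V : Type*} [NormedAddCommGroup V] [InnerProductSpace ℝ V] [CompleteSpace V]
    (B : V →L[ℝ] V →L[ℝ] ℝ)
    (hB_nondeg : ∀ w : V, (∀ φ : V, B φ w = 0) → w = 0)
    (L : V →L[ℝ] ℝ) (Vh : Submodule ℝ V)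
    (J : V → ℝ) (hJ : Differentiable ℝ J)
    (u : V) (hu : ∀ φ : V, B u φ = L φ)
    (u_h : V) (hu_h_mem : u_h ∈ Vh)
    (hu_h : ∀ φ_h ∈ Vh, B u_h φ_h = L φ_h)
    (z : V) (hz : ∀ φ : V, B φ z = fderiv ℝ J u_h φ)
    (ψ_h : V) (hψ_mem : ψ_h ∈ Vh)
    (hψ : ∀ φ : V, fderiv ℝ J u_h φ = B φ ψ_h) :
    L z - B u_h z = 0 ∧
      (J u ≠ J u_h →
        ¬ ∃ C : ℝ, 0 < C ∧ |J u - J u_h| ≤ C * |L z - B u_h z|) := by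
  have hzψ : z = ψ_h := by
    refine sub_eq_zero.mp (hB_nondeg _ fun φ => ?_)
    rw [map_sub, hz, hψ, sub_self]
  have hη : L z - B u_h z = 0 := by
    rw [hzψ, hu_h ψ_h hψ_mem, sub_self]
  refine ⟨hη, ?_⟩
  rintro hJne ⟨C, -, hC⟩
  rw [hη, abs_zero, mul_zero] at hC
  exact hJne (sub_eq_zero.mp (abs_nonpos_iff.mp hC))
end

section
/- Let V be a real Hilbert space, B : V × V → ℝ a continuous bilinear form, L : V → ℝ a continuous linear functional, V_h ⊆ V_h⁺ subspaces of V, and J : V → ℝ Fréchet differentiable. Assume B is nondegenerate in its second argument on V_h⁺ (for w ∈ V_h⁺, if B(φ, w) = 0 for all φ ∈ V_h⁺ then w = 0). Suppose u ∈ V satisfies B(u, φ) = L(φ) for all φ ∈ V; u_h ∈ V_h satisfies B(u_h, φ_h) = L(φ_h) for all φ_h ∈ V_h; z_h⁺ ∈ V_h⁺ satisfies B(φ, z_h⁺) = J'(u_h)(φ) for all φ ∈ V_h⁺; and there exists ψ_h ∈ V_h such that J'(u_h)(φ) = B(φ, ψ_h) for all φ ∈ V. Then z_h⁺ = ψ_h,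 the estimate η₃ := L(z_h⁺) − B(u_h, z_h⁺) equals 0, and consequently, if J(u) ≠ J(u_h), there exists no constant C > 0 such that |J(u) − J(u_h)| ≤ C · |η₃|. -/
/-- Theorem 2 of the paper: if `J'(u_h)(·) = B(·, ψ_h)` with `ψ_h ∈ V_h ⊆ V_h⁺`
and `B` is nondegenerate in its second argument on `V_h⁺`, then the discrete
adjoint solution satisfies `z_h⁺ = ψ_h`, the estimate
`η₃ := L(z_h⁺) - B(u_h, z_h⁺)` vanishes, and whenever `J(u) ≠ J(u_h)` there is
no constant `C > 0` with `|J(u) - J(u_h)| ≤ C |η₃|`. -/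
theorem eta3_not_reliable
    {V : Type*} [NormedAddCommGroup V] [InnerProductSpace ℝ V] [CompleteSpace V]
    (B : V →L[ℝ] V →L[ℝ] ℝ) (L : V →L[ℝ] ℝ)
    (Vh Vhp : Submodule ℝ V) (hVV : Vh ≤ Vhp)
    (J : V → ℝ) (hJ : Differentiable ℝ J)
    (hB_nondeg : ∀ w ∈ Vhp, (∀ φ ∈ Vhp, B φ w = 0) → w = 0)
    (u : V) (hu : ∀ φ : V, B u φ = L φ)
    (u_h : V) (hu_h_mem : u_h ∈ Vh)
    (hu_h : ∀ φ_h ∈ Vh, B u_h φ_h = L φ_h)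
    (z_hp : V) (hz_hp_mem : z_hp ∈ Vhp)
    (hz_hp : ∀ φ ∈ Vhp, B φ z_hp = fderiv ℝ J u_h φ)
    (ψ_h : V) (hψ_mem : ψ_h ∈ Vh)
    (hψ : ∀ φ : V, fderiv ℝ J u_h φ = B φ ψ_h) :
    z_hp = ψ_h ∧
      L z_hp - B u_h z_hp = 0 ∧
      (J u ≠ J u_h →
        ¬ ∃ C : ℝ, 0 < C ∧ |J u - J u_h| ≤ C * |L z_hp - B u_h z_hp|) := by
  have hz : z_hp = ψ_h := by
    refine sub_eq_zero.mp (hB_nondeg _ (Vhp.sub_mem hz_hp_mem (hVV hψ_mem)) fun φ hφ => ?_)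
    rw [map_sub, hz_hp φ hφ, hψ φ, sub_self]
  have hη : L z_hp - B u_h z_hp = 0 := by
    rw [hz, hu_h ψ_h hψ_mem, sub_self]
  refine ⟨hz, hη, ?_⟩
  rintro hne ⟨C, -, hle⟩
  rw [hη, abs_zero, mul_zero] at hle
  exact hne (sub_eq_zero.mp (abs_nonpos_iff.mp hle))
end

section
/- Let V be a real Hilbert space, B : V × V → ℝ a continuous symmetric bilinear form that is nondegenerate in its second argument (for w ∈ V, if B(φ, w) = 0 for all φ ∈ V then w = 0), L : V → ℝ a continuous linear functional, V_h a subspace of V, and G : ℝ → ℝ differentiable. Define J(v) := G(B(v, v)). Suppose u ∈ V satisfies B(u, φ) = L(φ) for all φ ∈ V; u_h ∈ V_h satisfies B(u_h, φ_h) = L(φ_h) for all φ_h ∈ V_h; and z ∈ V satisfies B(φ, z) = J'(u_h)(φ) for all φ ∈ V. Then the estimate η₂ := L(z) − B(u_h, z) equals 0, and consequently, if J(u) ≠ J(u_h), there exists no constant C > 0 such that |J(u) − J(u_h)| ≤ C · |η₂|. -/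
/-- The Fréchet derivative of `v ↦ G (B v v)` for a symmetric bilinear form `B`. -/
theorem hasFDerivAt_comp_quadratic {V : Type*} [NormedAddCommGroup V] [NormedSpace ℝ V]
    (B : V →L[ℝ] V →L[ℝ] ℝ) (hB_symm : ∀ v w : V, B v w = B w v)
    {G : ℝ → ℝ} {x : V} (hG : DifferentiableAt ℝ G (B x x)) :
    HasFDerivAt (fun v => G (B v v)) ((2 * deriv G (B x x)) • B x) x := by
  have hquad : HasFDerivAt (fun v => B v v) ((2 : ℝ) • B x) x := by
    refine (B.hasFDerivAt.clm_apply (hasFDerivAt_id x)).congr_fderiv ?_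
    ext φ
    simp [hB_symm φ x, two_mul]
  refine (HasDerivAt.comp_hasFDerivAt (h₂ := G) (f := fun v => B v v) x
    hG.hasDerivAt hquad).congr_fderiv ?_
  rw [smul_smul, mul_comm]

/-- Theorem 3 of the paper: for `J(v) := G(B(v, v))` with `B` symmetric and
nondegenerate in its second argument and `G` differentiable, the estimate
`η₂ := L(z) - B(u_h, z)` vanishes, so whenever `J(u) ≠ J(u_h)` there is no
constant `C > 0` with `|J(u) - J(u_h)| ≤ C |η₂|`. -/
theorem eta2_not_reliable_for_G_of_B
    {V : Type*} [NormedAddCommGroup V] [InnerProductSpace ℝ V] [CompleteSpace V]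
    (B : V →L[ℝ] V →L[ℝ] ℝ)
    (hB_symm : ∀ v w : V, B v w = B w v)
    (hB_nondeg : ∀ w : V, (∀ φ : V, B φ w = 0) → w = 0)
    (L : V →L[ℝ] ℝ) (Vh : Submodule ℝ V)
    (G : ℝ → ℝ) (hG : Differentiable ℝ G)
    (J : V → ℝ) (hJ : ∀ v : V, J v = G (B v v))
    (u : V) (hu : ∀ φ : V, B u φ = L φ)
    (u_h : V) (hu_h_mem : u_h ∈ Vh)
    (hu_h : ∀ φ_h ∈ Vh, B u_h φ_h = L φ_h)
    (z : V) (hz : ∀ φ : V, B φ z = fderiv ℝ J u_h φ) :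
    L z - B u_h z = 0 ∧
      (J u ≠ J u_h →
        ¬ ∃ C : ℝ, 0 < C ∧ |J u - J u_h| ≤ C * |L z - B u_h z|) := by
  have hJ_eq : J = fun v => G (B v v) := funext hJ
  have hz_eq : z = (2 * deriv G (B u_h u_h)) • u_h := by
    refine sub_eq_zero.mp (hB_nondeg _ fun φ => ?_)
    rw [map_sub, hz, hJ_eq, (hasFDerivAt_comp_quadratic B hB_symm (hG _)).fderiv]
    simp [hB_symm φ u_h]
  have h_zero : L z - B u_h z = 0 := by
    rw [hu_h z (hz_eq ▸ Vh.smul_mem _ hu_h_mem), sub_self]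
  refine ⟨h_zero, ?_⟩
  rintro hne ⟨C, -, hC⟩
  rw [h_zero, abs_zero, mul_zero] at hC
  exact hne (sub_eq_zero.mp (abs_nonpos_iff.mp hC))
end

section
/- Let V be a real Hilbert space, B : V × V → ℝ a continuous symmetric bilinear form that is nondegenerate in its second argument (for w ∈ V, if B(φ, w) = 0 for all φ ∈ V then w = 0), L : V → ℝ a continuous linear functional, and V_h a subspace of V. Define the energy functional J(v) := √(B(v, v)). Suppose u ∈ V satisfies B(u, φ) = L(φ) for all φ ∈ V; u_h ∈ V_h satisfies B(u_h, φ_h) = L(φ_h) for all φ_h ∈ V_h with B(u_h, u_h) > 0; and z ∈ V satisfies B(φ, z) = J'(u_h)(φ) for all φ ∈ V. Then the estimate η₂ := L(z) − B(u_h, z) equals 0, and consequently, if J(u) ≠ J(u_h), there exists no constant C > 0 such that |J(u) − J(u_h)| ≤ C · |η₂|. -/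
/-- The energy `v ↦ √(B v v)` of a symmetric bilinear form has derivative
`φ ↦ B φ x / √(B x x)` at every `x` with `B x x ≠ 0`. -/
theorem fderiv_sqrt_bilin_self {V : Type*} [NormedAddCommGroup V] [NormedSpace ℝ V]
    (B : V →L[ℝ] V →L[ℝ] ℝ) (hB : ∀ v w : V, B v w = B w v) {x : V} (hx : B x x ≠ 0) (φ : V) :
    fderiv ℝ (fun v => √(B v v)) x φ = (√(B x x))⁻¹ * B φ x := by
  have h : HasFDerivAt (fun v => B v v) _ x := B.hasFDerivAt.clm_apply (hasFDerivAt_id x)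
  rw [(h.sqrt hx).fderiv]
  simp [hB x φ]
  ring

/-- Corollary 1 of the paper: for the energy functional `J(v) := √(B(v, v))`
induced by a symmetric, nondegenerate (in the second argument) continuous
bilinear form `B`, with `B(u_h, u_h) > 0`, the estimate
`η₂ := L(z) - B(u_h, z)` vanishes, so whenever `J(u) ≠ J(u_h)` there is no
constant `C > 0` with `|J(u) - J(u_h)| ≤ C |η₂|`. -/
theorem eta2_not_reliable_for_energy
    {V : Type*} [NormedAddCommGroup V] [InnerProductSpace ℝ V] [CompleteSpace V]
    (B : V →L[ℝ] V →L[ℝ] ℝ)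
    (hB_symm : ∀ v w : V, B v w = B w v)
    (hB_nondeg : ∀ w : V, (∀ φ : V, B φ w = 0) → w = 0)
    (L : V →L[ℝ] ℝ) (Vh : Submodule ℝ V)
    (J : V → ℝ) (hJ : ∀ v : V, J v = Real.sqrt (B v v))
    (u : V) (hu : ∀ φ : V, B u φ = L φ)
    (u_h : V) (hu_h_mem : u_h ∈ Vh)
    (hu_h : ∀ φ_h ∈ Vh, B u_h φ_h = L φ_h)
    (hpos : 0 < B u_h u_h)
    (z : V) (hz : ∀ φ : V, B φ z = fderiv ℝ J u_h φ) :
    L z - B u_h z = 0 ∧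
      (J u ≠ J u_h →
        ¬ ∃ C : ℝ, 0 < C ∧ |J u - J u_h| ≤ C * |L z - B u_h z|) := by
  obtain rfl : J = fun v => √(B v v) := funext hJ
  have hz_eq : z = (√(B u_h u_h))⁻¹ • u_h := by
    refine sub_eq_zero.mp (hB_nondeg _ fun φ => ?_)
    rw [map_sub, hz, fderiv_sqrt_bilin_self B hB_symm hpos.ne', map_smul, smul_eq_mul, sub_self]
  have hη : L z - B u_h z = 0 := by
    rw [hu_h z (hz_eq ▸ Vh.smul_mem _ hu_h_mem), sub_self]
  refine ⟨hη, ?_⟩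
  rintro hne ⟨C, -, hC⟩
  rw [hη, abs_zero, mul_zero] at hC
  exact hne (sub_eq_zero.mp (abs_nonpos_iff.mp hC))
end
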